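/- For all integers m ≥ 1 and 0 ≤ i ≤ m+1, the Boros–Moll coefficients satisfy the recurrence 2(m+1)·d_i(m+1) = 2(m+i)·d_{i-1}(m) + (4m+2i+3)·d_i(m), where d_{-1}(m) and d_{m+1}(m) are interpreted as 0. -/

import Mathlib

/-- The Boros-Moll coefficient `d_i(m)` with integer index `i`, as a real number;
it is `0` for `i < 0` (and automatically `0` for `i > m`, since `C(k, i) = 0` there). -/
noncomputable def d (m : ℕ) (i : ℤ) : ℝ :=
  if 0 ≤ i then
    (∑ k ∈ Finset.range (m + 1),
        (2 : ℝ) ^ k * (Nat.choose (2 * m - 2 * k) (m - k) : ℝ) *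
          (Nat.choose (m + k) m : ℝ) * (Nat.choose k i.toNat : ℝ)) / 4 ^ m
  else 0

/-- The coefficient of `(1 + x) ^ k` in the `m`-th Boros-Moll polynomial. -/
noncomputable def borosMollCoeff (m k : ℕ) : ℝ :=
  if k ≤ m then
    (2 : ℝ) ^ k * (Nat.centralBinom (m - k) : ℝ) * (Nat.choose (m + k) m : ℝ) / 4 ^ m
  else 0

theorem borosMollCoeff_add (n k : ℕ) :
    borosMollCoeff (n + k) k =
      (2 : ℝ) ^ k * (Nat.centralBinom n : ℝ) * (Nat.choose (n + k + k) k : ℝ) / 4 ^ (n + k) := by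
  rw [borosMollCoeff, if_pos (Nat.le_add_left k n), Nat.add_sub_cancel, Nat.choose_symm_add]

theorem borosMollCoeff_of_lt {m k : ℕ} (h : m < k) : borosMollCoeff m k = 0 :=
  if_neg (Nat.not_le.mpr h)

theorem d_natCast (m i : ℕ) :
    d m i = ∑ k ∈ Finset.range (m + 1), borosMollCoeff m k * (Nat.choose k i : ℝ) := by
  rw [d, if_pos (Int.natCast_nonneg i), Finset.sum_div]
  refine Finset.sum_congr rfl fun k hk => ?_
  have hk' : k ≤ m := Nat.lt_succ_iff.mp (Finset.mem_range.mp hk)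
  rw [borosMollCoeff, if_pos hk', Nat.centralBinom, Nat.mul_sub, Int.toNat_natCast]
  ring

theorem cast_succ_mul_centralBinom_succ (n : ℕ) :
    ((n : ℝ) + 1) * (Nat.centralBinom (n + 1) : ℝ) =
      2 * (2 * n + 1) * (Nat.centralBinom n : ℝ) := by
  exact_mod_cast Nat.succ_mul_centralBinom_succ n

theorem succ_mul_borosMollCoeff_succ_left (n k : ℕ) :
    2 * ((n : ℝ) + 1) * ((n : ℝ) + k + 1) * borosMollCoeff (n + k + 1) k =
      (2 * n + 1) * ((n : ℝ) + 2 * k + 1) * borosMollCoeff (n + k) k := by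
  have hb := cast_succ_mul_centralBinom_succ n
  have hc : ((n : ℝ) + 2 * k + 1) * (Nat.choose (n + k + k) k : ℝ) =
      (Nat.choose (n + k + k + 1) k : ℝ) * (n + k + 1) := by
    have h := Nat.choose_mul_succ_eq (n + k + k) k
    rw [show n + k + k + 1 - k = n + k + 1 by omega] at h
    have h' : (Nat.choose (n + k + k) k : ℝ) * ((n : ℝ) + k + k + 1) =
      (Nat.choose (n + k + k + 1) k : ℝ) * (n + k + 1) := by exact_mod_cast h
    linear_combination h'
  have e := borosMollCoeff_add (n + 1) k
  rw [show n + 1 + k = n + k + 1 by omega, show n + k + 1 + k = n + k + k + 1 by omega] at e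
  rw [e, borosMollCoeff_add, pow_succ]
  field_simp
  linear_combination 2 * (Nat.choose (n + k + k + 1) k : ℝ) * ((n : ℝ) + k + 1) * hb -
    4 * (2 * (n : ℝ) + 1) * (Nat.centralBinom n : ℝ) * hc

theorem mul_borosMollCoeff_pred_right (n k : ℕ) :
    ((n : ℝ) + 1) * ((n : ℝ) + 2 * k + 2) * borosMollCoeff (n + k + 1) k =
      (2 * n + 1) * ((k : ℝ) + 1) * borosMollCoeff (n + k + 1) (k + 1) := by
  have hb := cast_succ_mul_centralBinom_succ n
  have hc : ((n : ℝ) + 2 * k + 2) * (Nat.choose (n + k + 1 + k) k : ℝ) =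
      (Nat.choose (n + k + 1 + k + 1) (k + 1) : ℝ) * (k + 1) := by
    have h := Nat.add_one_mul_choose_eq (n + k + 1 + k) k
    have h' : ((n : ℝ) + k + 1 + k + 1) * (Nat.choose (n + k + 1 + k) k : ℝ) =
      (Nat.choose (n + k + 1 + k + 1) (k + 1) : ℝ) * (k + 1) := by exact_mod_cast h
    linear_combination h'
  have e := borosMollCoeff_add (n + 1) k
  rw [show n + 1 + k = n + k + 1 by omega] at e
  have e' := borosMollCoeff_add n (k + 1)
  rw [show n + (k + 1) = n + k + 1 by omega,
    show n + k + 1 + (k + 1) = n + k + 1 + k + 1 by omega] at e'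
  rw [e, e', pow_succ (2 : ℝ)]
  field_simp
  linear_combination (Nat.choose (n + k + 1 + k) k : ℝ) * ((n : ℝ) + 2 * k + 2) * hb +
    2 * (2 * (n : ℝ) + 1) * (Nat.centralBinom n : ℝ) * hc

theorem borosMollCoeff_succ_zero (m : ℕ) :
    2 * ((m : ℝ) + 1) * borosMollCoeff (m + 1) 0 = (2 * m + 1) * borosMollCoeff m 0 := by
  have h := succ_mul_borosMollCoeff_succ_left m 0
  simp only [Nat.add_zero, Nat.cast_zero] at h
  have hm : (m : ℝ) + 1 ≠ 0 := by positivity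
  apply mul_left_cancel₀ hm
  linear_combination h

theorem borosMollCoeff_succ_succ {m k : ℕ} (hk : k ≤ m) :
    2 * ((m : ℝ) + 1) * borosMollCoeff (m + 1) (k + 1) =
      2 * ((m : ℝ) + k + 1) * borosMollCoeff m k +
        (2 * m - 2 * k - 1) * borosMollCoeff m (k + 1) := by
  obtain ⟨n, rfl⟩ := Nat.exists_eq_add_of_le' hk
  rcases n with _ | n
  · have hl := succ_mul_borosMollCoeff_succ_left 0 k
    have hr := mul_borosMollCoeff_pred_right 0 k
    rw [borosMollCoeff_of_lt (show 0 + k < k + 1 by omega)]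
    simp only [Nat.zero_add, Nat.cast_zero] at hl hr ⊢
    have hk' : (k : ℝ) + 1 ≠ 0 := by positivity
    apply mul_left_cancel₀ hk'
    linear_combination -2 * ((k : ℝ) + 1) * hr + 2 * ((k : ℝ) + 1) * hl
  · have hl := succ_mul_borosMollCoeff_succ_left n (k + 1)
    have hr := mul_borosMollCoeff_pred_right n k
    rw [show n + (k + 1) = n + k + 1 by omega] at hl
    rw [show n + 1 + k = n + k + 1 by omega]
    push_cast at hl ⊢
    have hn : (n : ℝ) + 1 ≠ 0 := by positivity
    apply mul_left_cancel₀ hn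
    linear_combination hl - 2 * hr

theorem succ_mul_sum_borosMollCoeff_succ (m : ℕ) (f : ℕ → ℝ) :
    2 * ((m : ℝ) + 1) * ∑ k ∈ Finset.range (m + 2), borosMollCoeff (m + 1) k * f k =
      ∑ k ∈ Finset.range (m + 1), borosMollCoeff m k *
        (2 * ((m : ℝ) + k + 1) * f (k + 1) + (2 * m + 1 - 2 * k) * f k) := by
  have hshift : ∑ k ∈ Finset.range (m + 1), (2 * (m : ℝ) + 1 - 2 * k) * borosMollCoeff m k * f k =
      ∑ k ∈ Finset.range (m + 1),
        (2 * (m : ℝ) - 2 * k - 1) * borosMollCoeff m (k + 1) * f (k + 1) +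
        (2 * m + 1) * borosMollCoeff m 0 * f 0 := by
    have h := Finset.sum_range_succ
      (fun k : ℕ => (2 * (m : ℝ) + 1 - 2 * k) * borosMollCoeff m k * f k) (m + 1)
    rw [Finset.sum_range_succ', borosMollCoeff_of_lt (Nat.lt_succ_self m)] at h
    rw [mul_zero, zero_mul, add_zero] at h
    rw [← h]
    congr 1
    · refine Finset.sum_congr rfl fun k _ => ?_
      push_cast
      ring
    · simp
  calc 2 * ((m : ℝ) + 1) * ∑ k ∈ Finset.range (m + 2), borosMollCoeff (m + 1) k * f k
      = ∑ k ∈ Finset.range (m + 1),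
          (2 * ((m : ℝ) + 1) * borosMollCoeff (m + 1) (k + 1)) * f (k + 1) +
          (2 * ((m : ℝ) + 1) * borosMollCoeff (m + 1) 0) * f 0 := by
        rw [Finset.sum_range_succ', mul_add, Finset.mul_sum]
        simp only [mul_assoc]
    _ = ∑ k ∈ Finset.range (m + 1), (2 * ((m : ℝ) + k + 1) * borosMollCoeff m k * f (k + 1) +
          (2 * (m : ℝ) - 2 * k - 1) * borosMollCoeff m (k + 1) * f (k + 1)) +
          (2 * m + 1) * borosMollCoeff m 0 * f 0 := by
        rw [borosMollCoeff_succ_zero]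
        congr 1
        refine Finset.sum_congr rfl fun k hk => ?_
        rw [borosMollCoeff_succ_succ (Nat.lt_succ_iff.mp (Finset.mem_range.mp hk)), add_mul]
    _ = _ := by
        rw [Finset.sum_add_distrib, add_assoc, ← hshift, ← Finset.sum_add_distrib]
        refine Finset.sum_congr rfl fun k _ => ?_
        ring

theorem cast_succ_mul_choose_succ (k j : ℕ) :
    ((j : ℝ) + 1) * (Nat.choose k (j + 1) : ℝ) = ((k : ℝ) - j) * (Nat.choose k j : ℝ) := by
  have h := Nat.add_one_mul_choose_eq k j
  rw [Nat.choose_succ_succ'] at h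
  have h' : ((k : ℝ) + 1) * (Nat.choose k j : ℝ) =
      ((Nat.choose k j : ℝ) + (Nat.choose k (j + 1) : ℝ)) * (j + 1) := by exact_mod_cast h
  linear_combination -h'

theorem boros_moll_recurrence (m : ℕ) (hm : 1 ≤ m) (i : ℤ) (h0 : 0 ≤ i)
    (h1 : i ≤ (m : ℤ) + 1) :
    2 * ((m : ℝ) + 1) * d (m + 1) i =
      2 * ((m : ℝ) + (i : ℝ)) * d m (i - 1) + (4 * (m : ℝ) + 2 * (i : ℝ) + 3) * d m i := by
  lift i to ℕ using h0
  rw [d_natCast, d_natCast, succ_mul_sum_borosMollCoeff_succ]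
  rcases i with _ | j
  · have hneg : d m (((0 : ℕ) : ℤ) - 1) = 0 := if_neg (by norm_num)
    rw [hneg, mul_zero, zero_add, Finset.mul_sum]
    refine Finset.sum_congr rfl fun k _ => ?_
    simp only [Nat.choose_zero_right, Nat.cast_one, Nat.cast_zero, Int.cast_zero]
    ring
  · rw [show ((j + 1 : ℕ) : ℤ) - 1 = (j : ℤ) by push_cast; ring, d_natCast, Finset.mul_sum,
      Finset.mul_sum, ← Finset.sum_add_distrib]
    refine Finset.sum_congr rfl fun k _ => ?_
    rw [Nat.choose_succ_succ']
    push_cast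
    linear_combination (-2 * borosMollCoeff m k) * cast_succ_mul_choose_succ k j
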